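/- arXiv:1004.2338 — 4 statements merged into one kernel-verified Lean document; each statement's English description precedes it below -/
import Mathlib

section
/- Let n = 2k+1 with k ≥ 1, and let a_1, …, a_n be nonnegative real numbers; write m_i for the i-th smallest, M_i for the i-th largest, and mid for the median ((k+1)-th smallest) of these values. Then the minimum of SOP(π) = Σ_{i=1}^n a_{π_i}·a_{π_{i⊕1}} over all circular permutations π of {1,…,n} equals m_1·M_1 + m_k·mid + mid·M_k + Σ_{i=1}^{k−1} (M_i·m_{i+1} + m_i·M_{i+1}); in particular this value is attained by the circular arrangement whose cyclically adjacent pairs are exactly {M_1,m_1}, {m_k,mid}, {mid,M_k}, and {M_i,m_{i+1}}, {m_i,M_{i+1}} for i = 1,…,k−1. -/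
/-- The cyclic successor `i ⊕ 1` in `Fin n`. -/
def cycSucc {n : ℕ} (i : Fin n) : Fin n :=
  ⟨(i.val + 1) % n, Nat.mod_lt _ (Nat.lt_of_le_of_lt (Nat.zero_le i.val) i.isLt)⟩

/-- The sum of adjacent products of a circular arrangement `π` of the values `a`. -/
noncomputable def SOP {n : ℕ} (a : Fin n → ℝ) (π : Equiv.Perm (Fin n)) : ℝ :=
  ∑ i : Fin n, a (π i) * a (π (cycSucc i))

/-- The increments of `b`, whose partial sums recover `b`. -/
def increment (b : ℕ → ℝ) : ℕ → ℝ
  | 0 => b 0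
  | s + 1 => b (s + 1) - b s

/-- The indicator of the up-set `{j | s ≤ j}`. -/
def upInd (s j : ℕ) : ℝ := if s ≤ j then 1 else 0

lemma upInd_mul (s t u v : ℕ) :
    upInd s u * upInd t v = if s ≤ u ∧ t ≤ v then 1 else 0 := by
  unfold upInd
  split_ifs <;> simp_all

lemma upInd_nonneg (s j : ℕ) : 0 ≤ upInd s j := by
  unfold upInd
  split_ifs <;> norm_num

lemma sum_increment (b : ℕ → ℝ) (j : ℕ) :
    ∑ s ∈ Finset.range (j + 1), increment b s = b j := by
  induction j with
  | zero => simp [increment]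
  | succ j ih => rw [Finset.sum_range_succ, ih]; simp [increment]

lemma eq_sum_increment_mul_upInd (b : ℕ → ℝ) {n j : ℕ} (hj : j < n) :
    b j = ∑ s ∈ Finset.range n, increment b s * upInd s j := by
  rw [← sum_increment b j]
  simp only [upInd, mul_ite, mul_one, mul_zero]
  rw [← Finset.sum_filter]
  congr 1
  ext s
  simp only [Finset.mem_range, Finset.mem_filter]
  omega

/-- Layer decomposition of a sum of products of values of `b`. -/
lemma sum_mul_eq_layers {ι : Type*} (I : Finset ι) (b : ℕ → ℝ) (n : ℕ) (u v : ι → ℕ)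
    (hu : ∀ i ∈ I, u i < n) (hv : ∀ i ∈ I, v i < n) :
    ∑ i ∈ I, b (u i) * b (v i) = ∑ s ∈ Finset.range n, ∑ t ∈ Finset.range n,
      increment b s * increment b t * ∑ i ∈ I, upInd s (u i) * upInd t (v i) := by
  have h : ∀ i ∈ I, b (u i) * b (v i) = ∑ s ∈ Finset.range n, ∑ t ∈ Finset.range n,
      increment b s * increment b t * (upInd s (u i) * upInd t (v i)) := by
    intro i hi
    rw [eq_sum_increment_mul_upInd b (hu i hi), eq_sum_increment_mul_upInd b (hv i hi),
      Finset.sum_mul_sum]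
    refine Finset.sum_congr rfl fun s _ => Finset.sum_congr rfl fun t _ => ?_
    ring
  rw [Finset.sum_congr rfl h, Finset.sum_comm]
  refine Finset.sum_congr rfl fun s _ => ?_
  rw [Finset.sum_comm]
  refine Finset.sum_congr rfl fun t _ => ?_
  rw [Finset.mul_sum]

lemma sum_range_two_mul (f : ℕ → ℝ) (k : ℕ) :
    ∑ i ∈ Finset.range (2 * k), f i = ∑ i ∈ Finset.range k, (f i + f (2 * k - 1 - i)) := by
  rw [two_mul, Finset.sum_range_add, Finset.sum_add_distrib,
    ← Finset.sum_range_reflect (fun x => f (k + x))]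
  congr 1
  refine Finset.sum_congr rfl fun i hi => ?_
  rw [Finset.mem_range] at hi
  congr 1
  omega

lemma sum_range_two_mul_add_one (f : ℕ → ℝ) (k : ℕ) :
    ∑ i ∈ Finset.range (2 * k + 1), f i
      = f k + ∑ i ∈ Finset.range k, (f i + f (2 * k - i)) := by
  rw [show 2 * k + 1 = k + 1 + k by omega, Finset.sum_range_add, Finset.sum_range_succ,
    Finset.sum_add_distrib, ← Finset.sum_range_reflect (fun x => f (k + 1 + x))]
  have h : ∑ j ∈ Finset.range k, f (k + 1 + (k - 1 - j))
      = ∑ i ∈ Finset.range k, f (2 * k - i) := by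
    refine Finset.sum_congr rfl fun i hi => ?_
    rw [Finset.mem_range] at hi
    congr 1
    omega
  rw [h]
  ring

/-- The optimal value, as a sum over the pairs of ranks adding up to `2k - 1`, `2k + 1`,
and the pair of extreme ranks. -/
lemma two_mul_optimum (b : ℕ → ℝ) {k : ℕ} (hk : 1 ≤ k) :
    2 * (b 0 * b (2 * k) + b (k - 1) * b k + b k * b (k + 1)
        + ∑ j ∈ Finset.range (k - 1),
            (b (2 * k - j) * b (j + 1) + b j * b (2 * k - 1 - j)))
      = ∑ u ∈ Finset.range (2 * k), b u * b (2 * k - 1 - u)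
        + ∑ u ∈ Finset.range (2 * k), b (u + 1) * b (2 * k - u)
        + (b 0 * b (2 * k) + b (2 * k) * b 0) := by
  obtain ⟨k, rfl⟩ : ∃ l, k = l + 1 := ⟨k - 1, by omega⟩
  rw [sum_range_two_mul, sum_range_two_mul, ← Finset.sum_add_distrib, Finset.sum_range_succ]
  have h : ∀ j ∈ Finset.range k,
      b j * b (2 * (k + 1) - 1 - j)
        + b (2 * (k + 1) - 1 - j) * b (2 * (k + 1) - 1 - (2 * (k + 1) - 1 - j))
        + (b (j + 1) * b (2 * (k + 1) - j)
        + b (2 * (k + 1) - 1 - j + 1) * b (2 * (k + 1) - (2 * (k + 1) - 1 - j)))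
      = 2 * (b (2 * (k + 1) - j) * b (j + 1) + b j * b (2 * (k + 1) - 1 - j)) := by
    intro j hj
    rw [Finset.mem_range] at hj
    rw [show 2 * (k + 1) - 1 - (2 * (k + 1) - 1 - j) = j by omega,
      show 2 * (k + 1) - 1 - j + 1 = 2 * (k + 1) - j by omega,
      show 2 * (k + 1) - (2 * (k + 1) - 1 - j) = j + 1 by omega]
    ring
  rw [Finset.sum_congr rfl h, ← Finset.mul_sum,
    show 2 * (k + 1) - 1 - (2 * (k + 1) - 1 - k) = k by omega,
    show 2 * (k + 1) - (2 * (k + 1) - 1 - k) = k + 1 by omega,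
    show 2 * (k + 1) - 1 - k = k + 1 by omega,
    show 2 * (k + 1) - k = k + 1 + 1 by omega]
  simp only [Nat.add_sub_cancel]
  ring

lemma sum_upInd_low (k s t : ℕ) :
    ∑ u ∈ Finset.range (2 * k), upInd s u * upInd t (2 * k - 1 - u)
      = ((2 * k - t - s : ℕ) : ℝ) := by
  simp only [upInd_mul, Finset.sum_boole]
  rw [← Nat.card_Ico s (2 * k - t)]
  congr 2
  ext u
  simp only [Finset.mem_filter, Finset.mem_range, Finset.mem_Ico]
  omega

lemma sum_upInd_high (k s t : ℕ) :
    ∑ u ∈ Finset.range (2 * k), upInd s (u + 1) * upInd t (2 * k - u)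
      = ((min (2 * k + 1 - t) (2 * k) - (s - 1) : ℕ) : ℝ) := by
  simp only [upInd_mul, Finset.sum_boole]
  rw [← Nat.card_Ico (s - 1) (min (2 * k + 1 - t) (2 * k))]
  congr 2
  ext u
  simp only [Finset.mem_filter, Finset.mem_range, Finset.mem_Ico]
  omega

lemma cycSucc_bijective (n : ℕ) : Function.Bijective (cycSucc : Fin n → Fin n) := by
  rw [← Finite.injective_iff_bijective]
  intro i j h
  have hi := i.isLt
  have hj := j.isLt
  simp only [cycSucc, Fin.mk.injEq] at h
  apply Fin.ext
  rcases Nat.lt_or_ge (i.val + 1) n with h1 | h1 <;> rcases Nat.lt_or_ge (j.val + 1) n with h2 | h2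
  · rw [Nat.mod_eq_of_lt h1, Nat.mod_eq_of_lt h2] at h; omega
  · rw [Nat.mod_eq_of_lt h1, show j.val + 1 = n by omega, Nat.mod_self] at h; omega
  · rw [Nat.mod_eq_of_lt h2, show i.val + 1 = n by omega, Nat.mod_self] at h; omega
  · omega

lemma cycSucc_iterate_val {n : ℕ} (m : ℕ) (i : Fin n) :
    (cycSucc^[m] i).val = (i.val + m) % n := by
  induction m with
  | zero => simp [Nat.mod_eq_of_lt i.isLt]
  | succ m ih =>
    rw [Function.iterate_succ_apply']
    simp only [cycSucc, ih, Nat.mod_add_mod]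
    congr 1

lemma comp_iterate_eq {α β : Type*} {f : α → β} {g : α → α} (h : ∀ x, f (g x) = f x) (m : ℕ)
    (x : α) : f (g^[m] x) = f x := by
  induction m with
  | zero => rfl
  | succ m ih => rw [Function.iterate_succ_apply', h, ih]

/-- On an odd cycle, a function invariant under two-fold rotation is constant. -/
lemma eq_of_cycSucc_cycSucc {β : Type*} {k : ℕ} {f : Fin (2 * k + 1) → β}
    (h : ∀ i, f (cycSucc (cycSucc i)) = f i) (i j : Fin (2 * k + 1)) : f i = f j := by
  have h1 : ∀ i, f (cycSucc i) = f i := by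
    intro i
    rw [← comp_iterate_eq (g := cycSucc^[2]) h (k + 1) i, ← Function.iterate_mul]
    congr 1
    ext
    rw [cycSucc_iterate_val, show i.val + 2 * (k + 1) = i.val + 1 + (2 * k + 1) by ring,
      Nat.add_mod_right]
    rfl
  rw [← comp_iterate_eq h1 (j.val + (2 * k + 1) - i.val) i]
  congr 1
  ext
  rw [cycSucc_iterate_val,
    show i.val + (j.val + (2 * k + 1) - i.val) = j.val + (2 * k + 1) by omega,
    Nat.add_mod_right, Nat.mod_eq_of_lt j.isLt]

lemma sum_upInd_perm {n : ℕ} (c : Equiv.Perm (Fin n)) (s : ℕ) :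
    ∑ i, upInd s (c i) = ((n - s : ℕ) : ℝ) := by
  rw [Equiv.sum_comp c (fun i => upInd s i.val), Fin.sum_univ_eq_sum_range (fun i => upInd s i)]
  simp only [upInd, Finset.sum_boole]
  rw [← Nat.card_Ico]
  congr 2
  ext u
  simp only [Finset.mem_filter, Finset.mem_range, Finset.mem_Ico]
  omega

lemma sum_upInd_perm_cycSucc {n : ℕ} (c : Equiv.Perm (Fin n)) (s : ℕ) :
    ∑ i, upInd s (c (cycSucc i)) = ((n - s : ℕ) : ℝ) := by
  rw [← sum_upInd_perm c s]
  exact Function.Bijective.sum_comp (cycSucc_bijective n) (fun i => upInd s (c i))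

/-- The number of indices `i` with `s ≤ c i` and `t ≤ c (i ⊕ 1)`. -/
noncomputable def adjCount {n : ℕ} (c : Equiv.Perm (Fin n)) (s t : ℕ) : ℝ :=
  ∑ i, upInd s (c i) * upInd t (c (cycSucc i))

lemma adjCount_nonneg {n : ℕ} (c : Equiv.Perm (Fin n)) (s t : ℕ) : 0 ≤ adjCount c s t :=
  Finset.sum_nonneg fun _ _ => mul_nonneg (upInd_nonneg _ _) (upInd_nonneg _ _)

lemma adjCount_sub {n : ℕ} (c : Equiv.Perm (Fin n)) (s t : ℕ) (hs : s ≤ n) (ht : t ≤ n) :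
    adjCount c s t - ((n : ℝ) - s - t)
      = ∑ i, (1 - upInd s (c i)) * (1 - upInd t (c (cycSucc i))) := by
  have h : ∀ i, (1 - upInd s (c i)) * (1 - upInd t (c (cycSucc i)))
      = upInd s (c i) * upInd t (c (cycSucc i)) - upInd s (c i) - upInd t (c (cycSucc i)) + 1 := by
    intro i; ring
  simp only [h, Finset.sum_add_distrib, Finset.sum_sub_distrib, sum_upInd_perm,
    sum_upInd_perm_cycSucc, adjCount]
  rw [Nat.cast_sub hs, Nat.cast_sub ht]
  simp
  ring

lemma upInd_le_one (s j : ℕ) : upInd s j ≤ 1 := by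
  unfold upInd
  split_ifs <;> norm_num

lemma le_adjCount {n : ℕ} (c : Equiv.Perm (Fin n)) (s t : ℕ) (hs : s ≤ n) (ht : t ≤ n) :
    (n : ℝ) - s - t ≤ adjCount c s t := by
  rw [← sub_nonneg, adjCount_sub c s t hs ht]
  exact Finset.sum_nonneg fun i _ =>
    mul_nonneg (sub_nonneg.2 (upInd_le_one _ _)) (sub_nonneg.2 (upInd_le_one _ _))

lemma adjCount_eq_natCast {n : ℕ} (c : Equiv.Perm (Fin n)) (s t : ℕ) :
    ∃ m : ℕ, adjCount c s t = m := by
  simp only [adjCount, upInd_mul, Finset.sum_boole]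
  exact ⟨_, rfl⟩

/-- If `s + t = n` and no adjacency is counted, the two up-sets are complementary
along the cycle. -/
lemma le_iff_lt_of_adjCount_eq_zero {n : ℕ} (c : Equiv.Perm (Fin n)) {s t : ℕ}
    (hst : s + t = n) (h0 : adjCount c s t = 0) (i : Fin n) :
    s ≤ (c i).val ↔ (c (cycSucc i)).val < t := by
  have h1 := adjCount_sub c s t (by omega) (by omega)
  have hn : (n : ℝ) = s + t := by rw [← hst, Nat.cast_add]
  rw [h0, hn, show (0 : ℝ) - (s + t - s - t) = 0 by ring, eq_comm,
    Finset.sum_eq_zero_iff_of_nonneg fun i _ =>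
      mul_nonneg (sub_nonneg.2 (upInd_le_one _ _)) (sub_nonneg.2 (upInd_le_one _ _))] at h1
  have h2 := h1 i (Finset.mem_univ i)
  unfold adjCount at h0
  rw [Finset.sum_eq_zero_iff_of_nonneg fun i _ =>
      mul_nonneg (upInd_nonneg _ _) (upInd_nonneg _ _)] at h0
  have h3 := h0 i (Finset.mem_univ i)
  unfold upInd at h2 h3
  split_ifs at h2 h3 <;> first | omega | (norm_num at h2; done) | norm_num at h3

lemma one_le_adjCount_add {k : ℕ} (c : Equiv.Perm (Fin (2 * k + 1))) {s t : ℕ} (hs : 1 ≤ s)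
    (ht : 1 ≤ t) (hst : s + t = 2 * k + 1) : 1 ≤ adjCount c s t + adjCount c t s := by
  obtain ⟨m, hm⟩ := adjCount_eq_natCast c s t
  obtain ⟨l, hl⟩ := adjCount_eq_natCast c t s
  rcases Nat.eq_zero_or_pos (m + l) with h | h
  · have hA := le_iff_lt_of_adjCount_eq_zero c hst (by rw [hm]; norm_cast; omega)
    have hB := le_iff_lt_of_adjCount_eq_zero c (s := t) (t := s) (by omega)
      (by rw [hl]; norm_cast; omega)
    have hconst := eq_of_cycSucc_cycSucc (f := fun i => s ≤ (c i).val) (fun i => by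
      have h1 := hA i
      have h2 := hB (cycSucc i)
      apply propext
      omega)
    have h3 := hconst (c.symm ⟨0, by omega⟩) (c.symm ⟨2 * k, by omega⟩)
    simp only [Equiv.apply_symm_apply, eq_iff_iff] at h3
    omega
  · rw [hm, hl]
    exact_mod_cast h

lemma optimum_count_le {k : ℕ} (c : Equiv.Perm (Fin (2 * k + 1))) {s t : ℕ}
    (hs : s < 2 * k + 1) (ht : t < 2 * k + 1) :
    ∑ u ∈ Finset.range (2 * k), upInd s u * upInd t (2 * k - 1 - u)
      + ∑ u ∈ Finset.range (2 * k), upInd s (u + 1) * upInd t (2 * k - u)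
      + (upInd s 0 * upInd t (2 * k) + upInd s (2 * k) * upInd t 0)
      ≤ adjCount c s t + adjCount c t s := by
  rw [sum_upInd_low, sum_upInd_high]
  simp only [upInd, show s ≤ 2 * k by omega, show t ≤ 2 * k by omega, if_true, mul_one, one_mul,
    nonpos_iff_eq_zero]
  have h1 := le_adjCount c s t hs.le ht.le
  have h2 := le_adjCount c t s ht.le hs.le
  have h3 := adjCount_nonneg c s t
  have h4 := adjCount_nonneg c t s
  push_cast at h1 h2
  rcases Nat.eq_zero_or_pos s with rfl | hs0
  · rcases Nat.eq_zero_or_pos t with rfl | ht0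
    · simp at *
      linarith
    · rw [if_pos rfl, if_neg (by omega),
        show min (2 * k + 1 - t) (2 * k) - (0 - 1) = 2 * k + 1 - t by omega, Nat.sub_zero,
        Nat.cast_sub (by omega), Nat.cast_sub (by omega)]
      push_cast at *
      linarith
  · rcases Nat.eq_zero_or_pos t with rfl | ht0
    · rw [if_neg (by omega), if_pos rfl,
        show min (2 * k + 1 - 0) (2 * k) - (s - 1) = 2 * k + 1 - s by omega, Nat.sub_zero,
        Nat.cast_sub (by omega), Nat.cast_sub (by omega)]
      push_cast at *
      linarith
    · rw [if_neg (by omega), if_neg (by omega)]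
      rcases lt_trichotomy (s + t) (2 * k + 1) with h | h | h
      · rw [show min (2 * k + 1 - t) (2 * k) - (s - 1) = 2 * k + 2 - (s + t) by omega,
          Nat.sub_sub, add_comm t s, Nat.cast_sub (by omega), Nat.cast_sub (by omega)]
        push_cast at *
        linarith
      · rw [show min (2 * k + 1 - t) (2 * k) - (s - 1) = 1 by omega,
          show 2 * k - t - s = 0 by omega]
        have := one_le_adjCount_add c hs0 ht0 h
        push_cast
        linarith
      · rw [show min (2 * k + 1 - t) (2 * k) - (s - 1) = 0 by omega,
          show 2 * k - t - s = 0 by omega]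
        push_cast
        linarith

lemma increment_nonneg {b : ℕ → ℝ} {n : ℕ} (h0 : 0 ≤ b 0)
    (hb : ∀ i j : ℕ, i ≤ j → j < n → b i ≤ b j) {s : ℕ} (hs : s < n) : 0 ≤ increment b s := by
  cases s with
  | zero => exact h0
  | succ s => exact sub_nonneg.2 (hb s (s + 1) (by omega) hs)

lemma optimum_le {k : ℕ} (hk : 1 ≤ k) {b : ℕ → ℝ} (h0 : 0 ≤ b 0)
    (hb : ∀ i j : ℕ, i ≤ j → j < 2 * k + 1 → b i ≤ b j) (c : Equiv.Perm (Fin (2 * k + 1))) :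
    b 0 * b (2 * k) + b (k - 1) * b k + b k * b (k + 1)
        + ∑ j ∈ Finset.range (k - 1),
            (b (2 * k - j) * b (j + 1) + b j * b (2 * k - 1 - j))
      ≤ ∑ i, b (c i) * b (c (cycSucc i)) := by
  have hlow := sum_mul_eq_layers (Finset.range (2 * k)) b (2 * k + 1) (fun u => u)
    (fun u => 2 * k - 1 - u) (fun i hi => by rw [Finset.mem_range] at hi; omega)
    (fun i _ => by omega)
  have hhigh := sum_mul_eq_layers (Finset.range (2 * k)) b (2 * k + 1) (fun u => u + 1)
    (fun u => 2 * k - u) (fun i hi => by rw [Finset.mem_range] at hi; omega)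
    (fun i _ => by omega)
  have hext := sum_mul_eq_layers {()} b (2 * k + 1) (fun _ => 0) (fun _ => 2 * k)
    (fun _ _ => by omega) (fun _ _ => by omega)
  have hext' := sum_mul_eq_layers {()} b (2 * k + 1) (fun _ => 2 * k) (fun _ => 0)
    (fun _ _ => by omega) (fun _ _ => by omega)
  have hc := sum_mul_eq_layers Finset.univ b (2 * k + 1) (fun i => (c i).val)
    (fun i => (c (cycSucc i)).val) (fun i _ => (c i).isLt) (fun i _ => (c (cycSucc i)).isLt)
  have hc' := hc
  rw [Finset.sum_comm] at hc'
  simp only [Finset.sum_singleton] at hext hext'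
  suffices h : 2 * (b 0 * b (2 * k) + b (k - 1) * b k + b k * b (k + 1)
        + ∑ j ∈ Finset.range (k - 1),
            (b (2 * k - j) * b (j + 1) + b j * b (2 * k - 1 - j)))
      ≤ ∑ i, b (c i) * b (c (cycSucc i)) + ∑ i, b (c i) * b (c (cycSucc i)) by linarith
  rw [two_mul_optimum b hk, hlow, hhigh, hext, hext']
  nth_rewrite 1 [hc]
  rw [hc']
  simp only [← Finset.sum_add_distrib]
  refine Finset.sum_le_sum fun s hs => Finset.sum_le_sum fun t ht => ?_
  rw [Finset.mem_range] at hs ht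
  have h := mul_le_mul_of_nonneg_left (optimum_count_le c hs ht)
    (mul_nonneg (increment_nonneg h0 hb hs) (increment_nonneg h0 hb ht))
  unfold adjCount at h
  linarith

/-- The rank at position `j` of the optimal circular arrangement, which starts at the median. -/
def optRank (k j : ℕ) : ℕ :=
  if j % 2 = 1 then (if j ≤ k then k - j else j - k - 1)
  else (if j ≤ k then k + j else 3 * k + 1 - j)

lemma optRank_lt {k j : ℕ} (hj : j < 2 * k + 1) : optRank k j < 2 * k + 1 := by
  unfold optRank
  split_ifs <;> omega

lemma optRank_inj {k i j : ℕ} (hi : i < 2 * k + 1) (hj : j < 2 * k + 1)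
    (h : optRank k i = optRank k j) : i = j := by
  unfold optRank at h
  split_ifs at h <;> omega

/-- The optimal circular arrangement, as a permutation of the ranks. -/
noncomputable def optPerm (k : ℕ) : Equiv.Perm (Fin (2 * k + 1)) :=
  Equiv.ofBijective (fun j => ⟨optRank k j, optRank_lt j.isLt⟩)
    (Finite.injective_iff_bijective.1 fun i j h =>
      Fin.ext (optRank_inj i.isLt j.isLt (Fin.mk.inj h)))

lemma optRank_zero (k : ℕ) : optRank k 0 = k := by simp [optRank]

lemma sum_optPerm (b : ℕ → ℝ) {k : ℕ} (hk : 1 ≤ k) :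
    ∑ i, b (optPerm k i) * b (optPerm k (cycSucc i))
      = b 0 * b (2 * k) + b (k - 1) * b k + b k * b (k + 1)
        + ∑ j ∈ Finset.range (k - 1),
            (b (2 * k - j) * b (j + 1) + b j * b (2 * k - 1 - j)) := by
  have h1 : ∑ i, b (optPerm k i) * b (optPerm k (cycSucc i))
      = ∑ i ∈ Finset.range (2 * k + 1),
          b (optRank k i) * b (optRank k ((i + 1) % (2 * k + 1))) :=
    Fin.sum_univ_eq_sum_range
      (fun i => b (optRank k i) * b (optRank k ((i + 1) % (2 * k + 1)))) (2 * k + 1)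
  have hmid : b (optRank k k) * b (optRank k ((k + 1) % (2 * k + 1))) = b 0 * b (2 * k) := by
    rw [Nat.mod_eq_of_lt (by omega)]
    rcases Nat.mod_two_eq_zero_or_one k with h | h
    · rw [show optRank k k = 2 * k by unfold optRank; split_ifs <;> omega,
        show optRank k (k + 1) = 0 by unfold optRank; split_ifs <;> omega, mul_comm]
    · rw [show optRank k k = 0 by unfold optRank; split_ifs <;> omega,
        show optRank k (k + 1) = 2 * k by unfold optRank; split_ifs <;> omega]
  have hpair : ∀ i ∈ Finset.range k,
      b (optRank k i) * b (optRank k ((i + 1) % (2 * k + 1)))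
        + b (optRank k (2 * k - i)) * b (optRank k ((2 * k - i + 1) % (2 * k + 1)))
      = b (k - i) * b (k + i + 1) + b (k + i) * b (k - 1 - i) := by
    intro i hi
    rw [Finset.mem_range] at hi
    have hwrap : optRank k ((2 * k - i + 1) % (2 * k + 1))
        = if i % 2 = 1 then k + i else k - i := by
      rcases Nat.eq_zero_or_pos i with rfl | hi0
      · simp [optRank_zero]
      · rw [Nat.mod_eq_of_lt (by omega)]
        unfold optRank
        split_ifs <;> omega
    rw [hwrap, Nat.mod_eq_of_lt (by omega)]
    rcases Nat.mod_two_eq_zero_or_one i with h | h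
    · rw [show optRank k i = k + i by unfold optRank; split_ifs <;> omega,
        show optRank k (i + 1) = k - 1 - i by unfold optRank; split_ifs <;> omega,
        show optRank k (2 * k - i) = k + i + 1 by unfold optRank; split_ifs <;> omega,
        if_neg (by omega)]
      ring
    · rw [show optRank k i = k - i by unfold optRank; split_ifs <;> omega,
        show optRank k (i + 1) = k + i + 1 by unfold optRank; split_ifs <;> omega,
        show optRank k (2 * k - i) = k - 1 - i by unfold optRank; split_ifs <;> omega,
        if_pos h]
      ring
  rw [h1, sum_range_two_mul_add_one, hmid, Finset.sum_congr rfl hpair]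
  obtain ⟨k, rfl⟩ : ∃ l, k = l + 1 := ⟨k - 1, by omega⟩
  rw [Finset.sum_range_succ', ← Finset.sum_range_reflect, Nat.add_sub_cancel]
  have h2 : ∀ j ∈ Finset.range k,
      b (k + 1 - (k - 1 - j + 1)) * b (k + 1 + (k - 1 - j + 1) + 1)
        + b (k + 1 + (k - 1 - j + 1)) * b (k - (k - 1 - j + 1))
      = b (2 * (k + 1) - j) * b (j + 1) + b j * b (2 * (k + 1) - 1 - j) := by
    intro j hj
    rw [Finset.mem_range] at hj
    rw [show k + 1 - (k - 1 - j + 1) = j + 1 by omega,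
      show k + 1 + (k - 1 - j + 1) + 1 = 2 * (k + 1) - j by omega,
      show k + 1 + (k - 1 - j + 1) = 2 * (k + 1) - 1 - j by omega,
      show k - (k - 1 - j + 1) = j by omega]
    ring
  rw [Finset.sum_congr rfl h2]
  simp only [Nat.sub_zero, Nat.add_zero]
  ring

/-- For `n = 2k+1` nonnegative reals, with `b` a nondecreasing enumeration of the values
(`m_i = b (i-1)` is the `i`-th smallest, `mid = b k` the median, `M_i = b (2k+1-i)` the
`i`-th largest), the minimum of the sum of adjacent products over all circular
permutations equals
`m₁M₁ + m_k·mid + mid·M_k + ∑_{i=1}^{k-1} (M_i m_{i+1} + m_i M_{i+1})`, and it is attained. -/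
theorem DE1_odd (k : ℕ) (hk : 1 ≤ k) (a : Fin (2 * k + 1) → ℝ) (ha : ∀ i, 0 ≤ a i)
    (b : ℕ → ℝ)
    (hb_sorted : ∀ i j : ℕ, i ≤ j → j < 2 * k + 1 → b i ≤ b j)
    (hb_perm : ∃ e : Equiv.Perm (Fin (2 * k + 1)), ∀ i, a i = b (e i)) :
    IsLeast {s : ℝ | ∃ π : Equiv.Perm (Fin (2 * k + 1)), s = SOP a π}
      (b 0 * b (2 * k) + b (k - 1) * b k + b k * b (k + 1)
        + ∑ j ∈ Finset.range (k - 1),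
            (b (2 * k - j) * b (j + 1) + b j * b (2 * k - 1 - j))) := by
  obtain ⟨e, he⟩ := hb_perm
  have hSOP : ∀ π : Equiv.Perm (Fin (2 * k + 1)),
      SOP a π = ∑ i, b (π.trans e i) * b (π.trans e (cycSucc i)) := by
    intro π
    simp only [SOP, he, Equiv.trans_apply]
  have h0 : 0 ≤ b 0 := by
    have h := ha (e.symm ⟨0, by omega⟩)
    rwa [he, Equiv.apply_symm_apply] at h
  constructor
  · refine ⟨(optPerm k).trans e.symm, ?_⟩
    rw [hSOP, Equiv.trans_assoc, Equiv.symm_trans_self, Equiv.trans_refl, sum_optPerm b hk]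
  · rintro _ ⟨π, rfl⟩
    rw [hSOP]
    exact optimum_le hk h0 hb_sorted _
end

section
/- Let n ≥ 2, let w_0(i), w_1(i) > 0 for i = 1,…,n, and fix an assignment t ∈ {0,1}^n (sub-wedges may not be flipped). If a circular permutation σ of {1,…,n} satisfies AngResl_{σ,t} = max over all circular permutations σ' of AngResl_{σ',t}, then AspRatio_{σ,t} ≤ 2 · ( min over all circular permutations σ' of AspRatio_{σ',t} ). In other words, any ordering attaining the optimal angular resolution is a 2-approximation for the optimal aspect ratio of unordered trees with fixed uneven sub-wedges (the RA3 problem). -/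
/-- The `i`-th angle `θ_i = w_{t'_i}(σ_i) + w_{t_{i⊕1}}(σ_{i⊕1})` of the balloon drawing
given by circular permutation `σ` and sub-wedge assignment `t` (a `Bool`, with `!t i`
playing the role of `t'_i = 1 − t_i`). -/
noncomputable def theta {n : ℕ} (w : Fin n → Bool → ℝ) (σ : Equiv.Perm (Fin n))
    (t : Fin n → Bool) (i : Fin n) : ℝ :=
  w (σ i) (!t i) + w (σ (cycSucc i)) (t (cycSucc i))

/-- The angular resolution `AngResl_{σ,t} = min_i θ_i`. -/
noncomputable def angResl {n : ℕ} (w : Fin n → Bool → ℝ) (σ : Equiv.Perm (Fin n))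
    (t : Fin n → Bool) : ℝ :=
  sInf (Set.range (theta w σ t))

/-- The aspect ratio `AspRatio_{σ,t} = (max_i θ_i) / (min_i θ_i)`. -/
noncomputable def aspRatio {n : ℕ} (w : Fin n → Bool → ℝ) (σ : Equiv.Perm (Fin n))
    (t : Fin n → Bool) : ℝ :=
  sSup (Set.range (theta w σ t)) / sInf (Set.range (theta w σ t))

theorem cycSucc_surjective {n : ℕ} : Function.Surjective (cycSucc (n := n)) := by
  intro i
  have hi := i.isLt
  refine ⟨⟨(i.val + (n - 1)) % n, Nat.mod_lt _ (by omega)⟩, Fin.ext ?_⟩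
  have h : i.val + (n - 1) + 1 = i.val + n := by omega
  simp [cycSucc, Nat.mod_add_mod, h, Nat.mod_eq_of_lt hi]

/-- Every sub-wedge is contained in some angle of every drawing. -/
theorem exists_le_theta {n : ℕ} {w : Fin n → Bool → ℝ} (hw : ∀ i b, 0 < w i b)
    (σ : Equiv.Perm (Fin n)) (t : Fin n → Bool) (j : Fin n) (b : Bool) :
    ∃ i, w j b ≤ theta w σ t i := by
  obtain ⟨i, rfl⟩ := σ.surjective j
  by_cases hb : b = !t i
  · subst hb
    exact ⟨i, le_add_of_nonneg_right (hw _ _).le⟩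
  · have hb' : b = t i := by simpa using hb
    subst hb'
    obtain ⟨k, rfl⟩ := cycSucc_surjective i
    exact ⟨k, le_add_of_nonneg_left (hw _ _).le⟩

theorem le_sSup_range_theta {n : ℕ} {w : Fin n → Bool → ℝ} (hw : ∀ i b, 0 < w i b)
    (σ : Equiv.Perm (Fin n)) (t : Fin n → Bool) (j : Fin n) (b : Bool) :
    w j b ≤ sSup (Set.range (theta w σ t)) := by
  obtain ⟨i, hi⟩ := exists_le_theta hw σ t j b
  exact hi.trans (le_csSup (Set.finite_range _).bddAbove ⟨i, rfl⟩)

/-- The largest angles of any two drawings differ by at most a factor of two. -/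
theorem sSup_range_theta_le_two_mul {n : ℕ} [Nonempty (Fin n)] {w : Fin n → Bool → ℝ}
    (hw : ∀ i b, 0 < w i b) (σ σ' : Equiv.Perm (Fin n)) (t : Fin n → Bool) :
    sSup (Set.range (theta w σ t)) ≤ 2 * sSup (Set.range (theta w σ' t)) := by
  refine csSup_le (Set.range_nonempty _) ?_
  rintro _ ⟨i, rfl⟩
  rw [two_mul]
  exact add_le_add (le_sSup_range_theta hw σ' t _ _) (le_sSup_range_theta hw σ' t _ _)

theorem angResl_pos {n : ℕ} [Nonempty (Fin n)] {w : Fin n → Bool → ℝ}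
    (hw : ∀ i b, 0 < w i b) (σ : Equiv.Perm (Fin n)) (t : Fin n → Bool) :
    0 < angResl w σ t := by
  obtain ⟨i, hi⟩ := (Set.range_nonempty (theta w σ t)).csInf_mem (Set.finite_range _)
  rw [angResl, ← hi]
  exact add_pos (hw _ _) (hw _ _)

/-- Theorem 9 for RA3: with the sub-wedge assignment `t` fixed (no flipping allowed), any
ordering `σ` attaining the optimal angular resolution is a 2-approximation for the optimal
aspect ratio (unordered trees with fixed uneven sub-wedges). -/
theorem RA3_two_approximation (n : ℕ) (hn : 2 ≤ n) (w : Fin n → Bool → ℝ)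
    (hw : ∀ i b, 0 < w i b) (t : Fin n → Bool) (σ : Equiv.Perm (Fin n))
    (hopt : ∀ σ' : Equiv.Perm (Fin n), angResl w σ' t ≤ angResl w σ t) :
    aspRatio w σ t
      ≤ 2 * sInf {r : ℝ | ∃ σ' : Equiv.Perm (Fin n), r = aspRatio w σ' t} := by
  have : Nonempty (Fin n) := ⟨⟨0, by omega⟩⟩
  rw [← div_le_iff₀' two_pos]
  refine le_csInf ⟨_, σ, rfl⟩ ?_
  rintro _ ⟨σ', rfl⟩
  rw [div_le_iff₀' two_pos]
  calc aspRatio w σ t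
      ≤ (2 * sSup (Set.range (theta w σ' t))) / angResl w σ' t := by
        refine div_le_div₀ ?_ (sSup_range_theta_le_two_mul hw σ σ' t)
          (angResl_pos hw σ' t) (hopt σ')
        obtain ⟨j⟩ := this
        exact mul_nonneg two_pos.le
          ((hw j true).le.trans (le_sSup_range_theta hw σ' t j true))
    _ = 2 * aspRatio w σ' t := mul_div_assoc _ _ _
end

section
/- Let n ≥ 1 and let w_0(i), w_1(i) ≥ 0 for i = 1,…,n. Among the 2n sub-wedge values {w_0(1), w_1(1), …, w_0(n), w_1(n)}, let M_i denote the i-th largest and m_i the i-th smallest. Then for every circular permutation σ of {1,…,n} and every assignment t ∈ {0,1}^n, AngResl_{σ,t} ≤ min_{1≤i≤n} (M_i + m_i); in particular the optimal angular resolution for unordered trees with flexible uneven sub-wedges (the RE4 problem) is at most min_{1≤i≤n} (M_i + m_i). -/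
theorem cycSucc_injective {n : ℕ} : Function.Injective (cycSucc (n := n)) := by
  intro i k h
  have h' : (i.val + 1) % n = (k.val + 1) % n := congrArg Fin.val h
  have hm : i.val ≡ k.val [MOD n] := Nat.ModEq.add_right_cancel' 1 h'
  exact Fin.ext (hm.eq_of_lt_of_lt i.isLt k.isLt)

/-- The two sub-wedges bounding the `i`-th angle, indexed by a side. -/
def angleSide {n : ℕ} (σ : Equiv.Perm (Fin n)) (t : Fin n → Bool) : Fin n × Bool → Fin n × Bool
  | (i, false) => (σ i, !t i)
  | (i, true) => (σ (cycSucc i), t (cycSucc i))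

theorem angleSide_injective {n : ℕ} (σ : Equiv.Perm (Fin n)) (t : Fin n → Bool) :
    Function.Injective (angleSide σ t) := by
  rintro ⟨i, _ | _⟩ ⟨k, _ | _⟩ h <;>
    simp only [angleSide, Prod.mk.injEq, EmbeddingLike.apply_eq_iff_eq] at h
  · rw [h.1]
  · obtain ⟨rfl, h⟩ := h
    simp at h
  · obtain ⟨rfl, h⟩ := h
    simp at h
  · rw [cycSucc_injective h.1]

theorem theta_eq_angleSide {n : ℕ} (w : Fin n → Bool → ℝ) (σ : Equiv.Perm (Fin n))
    (t : Fin n → Bool) (i : Fin n) (c : Bool) :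
    theta w σ t i = w (angleSide σ t (i, c)).1 (angleSide σ t (i, c)).2 +
      w (angleSide σ t (i, !c)).1 (angleSide σ t (i, !c)).2 := by
  cases c
  · rfl
  · exact add_comm _ _

theorem angResl_le_theta {n : ℕ} (w : Fin n → Bool → ℝ) (σ : Equiv.Perm (Fin n))
    (t : Fin n → Bool) (i : Fin n) : angResl w σ t ≤ theta w σ t i :=
  csInf_le (Set.finite_range _).bddBelow ⟨i, rfl⟩

/-- An injective self-map of `Fin m` sends one of the `j + 1` smallest elements outside the
`j` largest ones. -/
theorem exists_le_and_apply_le {m j : ℕ} (hj : j < m) (f : Fin m → Fin m)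
    (hf : Function.Injective f) : ∃ r : Fin m, r.val ≤ j ∧ (f r).val ≤ m - 1 - j := by
  by_contra! h
  have hlt (k : Fin (j + 1)) : (f (Fin.castLE hj k)).val - (m - j) < j := by
    have := h (Fin.castLE hj k) (Nat.le_of_lt_succ k.isLt)
    omega
  have hinj : Function.Injective fun k : Fin (j + 1) =>
      (⟨(f (Fin.castLE hj k)).val - (m - j), hlt k⟩ : Fin j) := by
    intro k l hkl
    have hk := h (Fin.castLE hj k) (Nat.le_of_lt_succ k.isLt)
    have hl := h (Fin.castLE hj l) (Nat.le_of_lt_succ l.isLt)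
    simp only [Fin.mk.injEq] at hkl
    have := hf (Fin.ext (by omega : (f (Fin.castLE hj k)).val = (f (Fin.castLE hj l)).val))
    exact Fin.castLE_injective hj this
  simpa using Fintype.card_le_of_injective _ hinj

/-- Property 1 for RE4: with `b` a nondecreasing enumeration of the `2n` sub-wedge values
(so `m_i = b (i-1)` is the `i`-th smallest and `M_i = b (2n-i)` the `i`-th largest), every
drawing `(σ, t)` satisfies `AngResl_{σ,t} ≤ M_i + m_i` for every `i ∈ {1,…,n}`; hence the
optimal angular resolution is at most `min_i (M_i + m_i)`. -/
theorem RE4_upper_bound (n : ℕ) (hn : 1 ≤ n) (w : Fin n → Bool → ℝ)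
    (hw : ∀ i b, 0 ≤ w i b)
    (b : ℕ → ℝ) (hb : ∀ i j : ℕ, i ≤ j → j < 2 * n → b i ≤ b j)
    (hperm : ∃ e : Fin n × Bool ≃ Fin (2 * n), ∀ p : Fin n × Bool, w p.1 p.2 = b (e p))
    (σ : Equiv.Perm (Fin n)) (t : Fin n → Bool) :
    ∀ j : ℕ, j < n → angResl w σ t ≤ b (2 * n - 1 - j) + b j := by
  intro j hj
  obtain ⟨e, he⟩ := hperm
  let s : Fin n × Bool ≃ Fin n × Bool :=
    Equiv.ofBijective _ (Finite.injective_iff_bijective.mp (angleSide_injective σ t))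
  let rank : Fin n × Bool ≃ Fin (2 * n) := s.trans e
  let flip : Fin n × Bool ≃ Fin n × Bool := (Equiv.refl _).prodCongr Equiv.boolNot
  obtain ⟨r, hr, hfr⟩ := exists_le_and_apply_le (by omega : j < 2 * n)
    ((rank.symm.trans flip).trans rank) (Equiv.injective _)
  obtain ⟨⟨i, c⟩, rfl⟩ := rank.surjective r
  simp only [Equiv.trans_apply, Equiv.symm_apply_apply] at hfr
  refine (angResl_le_theta w σ t i).trans ?_
  rw [theta_eq_angleSide w σ t i c, he, he, add_comm (b (2 * n - 1 - j))]
  exact add_le_add (hb _ _ hr (by omega)) (hb _ _ hfr (by omega))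
end

section
/- Let n ≥ 1, let W_{i1}, W_{i2} (i = 1,…,n) be positive reals, and let LB ≤ UB be reals. Set W_max = max over all i of max(W_{i1}, W_{i2}), ρ = 2π / Σ_{j=1}^n (W_{j1} + W_{j2} + W_max), w_0(i) = W_{i1}·ρ, w_1(i) = (W_{i2} + W_max)·ρ, A = (LB + W_max)·ρ, and B = (UB + W_max)·ρ. Then the following are equivalent: (i) there exists a circular permutation δ of {1,…,n} such that LB ≤ W_{δ_i,2} + W_{δ_{i⊕1},1} ≤ UB for every i = 1,…,n; (ii) there exist a circular permutation σ of {1,…,n} and an assignment t ∈ {0,1}^n such that A ≤ θ_i ≤ B for every i = 1,…,n. -/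
/-- One can read a list from its last entry backwards, attaching entries marked `false` at the
front and entries marked `true` at the back of an `R`-chain. -/
theorem exists_perm_isChain_of_marked {α : Type*} {R : α → α → Prop} {P Q : α → Prop}
    (hPQ : ∀ a b, P a → Q b → R a b) (t : α → Bool) (L : List α) : ∀ x : α,
    (x :: L).IsChain (fun a b => match t a, t b with
      | false, false => R a b
      | true, true => R b a
      | false, true => P a ∧ P b
      | true, false => Q a ∧ Q b) →
    (∀ z ∈ (x :: L).getLast?, t z = false ∧ P z) →
    ∃ l : List α, l.Perm (x :: L) ∧ l.IsChain R ∧ ∃ h ∈ l.head?, ∃ e ∈ l.getLast?,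
      if t x then e = x ∧ Q h else h = x ∧ P e := by
  induction L with
  | nil =>
    intro x _ hlast
    obtain ⟨hx, hP⟩ := hlast x (by simp)
    exact ⟨[x], .refl _, by simp, x, by simp, x, by simp, by simp [hx, hP]⟩
  | cons y L ih =>
    intro x hchain hlast
    rw [List.isChain_cons_cons] at hchain
    obtain ⟨l, hl, hR, h, hh, e, he, hinv⟩ :=
      ih y hchain.2 (fun z hz => hlast z (by simpa using hz))
    have hxy := hchain.1
    have prepend (hx : R x h) : (x :: l).IsChain R := by
      rw [List.isChain_cons]
      refine ⟨fun b hb => ?_, hR⟩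
      rwa [Option.mem_unique hb hh]
    have append (hx : R e x) : (l ++ [x]).IsChain R := by
      rw [List.isChain_append]
      refine ⟨hR, by simp, fun a ha b hb => ?_⟩
      have hb' : x = b := by simpa using hb
      rwa [Option.mem_unique ha he, ← hb']
    have hhead : h ∈ (l ++ [x]).head? := by
      cases l <;> simp_all
    have hend : e ∈ (x :: l).getLast? := by
      cases l <;> simp_all
    have hperm : (l ++ [x]).Perm (x :: y :: L) :=
      (List.perm_append_singleton x l).trans (hl.cons x)
    cases hx : t x <;> cases hy : t y <;> simp only [hx, hy] at hxy hinv
    · obtain ⟨rfl, hP⟩ : h = y ∧ P e := by simpa using hinv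
      exact ⟨x :: l, hl.cons x, prepend hxy, x, by simp, e, hend, by simp [hP]⟩
    · obtain ⟨rfl, hQ⟩ : e = y ∧ Q h := by simpa using hinv
      exact ⟨x :: l, hl.cons x, prepend (hPQ _ _ hxy.1 hQ), x, by simp, e, hend,
        by simp [hxy.2]⟩
    · obtain ⟨rfl, hP⟩ : h = y ∧ P e := by simpa using hinv
      exact ⟨l ++ [x], hperm, append (hPQ _ _ hP hxy.1), h, hhead, x, by simp, by simp [hxy.2]⟩
    · obtain ⟨rfl, hQ⟩ : e = y ∧ Q h := by simpa using hinv
      exact ⟨l ++ [x], hperm, append hxy, h, hhead, x, by simp, by simp [hQ]⟩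

theorem cycSucc_eq_add_one {m : ℕ} (i : Fin (m + 1)) : cycSucc i = i + 1 := by
  ext
  simp [cycSucc, Fin.val_add]

/-- A chain through all of `Fin n` whose last and first entries are related is a circular
permutation with related neighbours. -/
theorem exists_perm_of_isChain {n : ℕ} {R : Fin n → Fin n → Prop} {l : List (Fin n)}
    (hl : l.Perm (List.finRange n)) (hR : l.IsChain R) {h e : Fin n} (hh : h ∈ l.head?)
    (he : e ∈ l.getLast?) (heh : R e h) :
    ∃ δ : Equiv.Perm (Fin n), ∀ i, R (δ i) (δ (cycSucc i)) := by
  have hlen : l.length = n := by simpa using hl.length_eq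
  have hnodup : l.Nodup := hl.nodup_iff.2 (List.nodup_finRange n)
  have hinj : Function.Injective (fun i : Fin n => l[i.val]'(by omega)) := by
    intro i j hij
    exact Fin.ext ((hnodup.getElem_inj_iff).1 hij)
  refine ⟨Equiv.ofBijective _ (Finite.injective_iff_bijective.1 hinj), fun i => ?_⟩
  simp only [Equiv.ofBijective_apply, cycSucc]
  rcases Nat.lt_or_ge (i.val + 1) n with hi | hi
  · simp only [Nat.mod_eq_of_lt hi]
    exact List.isChain_iff_getElem.1 hR i.val (by omega)
  · have hin : i.val + 1 = n := by omega
    have h1 : l[0]'(by omega) = h := by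
      rw [List.head?_eq_getElem?] at hh
      exact (List.getElem?_eq_some_iff.1 hh).2
    have h2 : l[i.val]'(by omega) = e := by
      rw [List.getLast?_eq_getElem?] at he
      have := (List.getElem?_eq_some_iff.1 he).2
      simpa [hlen, ← hin] using this
    simp only [hin, Nat.mod_self, h1, h2, heh]

/-- If a cyclic sequence marked by `t` takes both values, some `false` is followed by `true`. -/
theorem exists_false_true_of_not_constant {m : ℕ} (t : Fin (m + 1) → Bool)
    (h0 : ∃ i, t i = false) (h1 : ∃ i, t i = true) : ∃ i, t i = false ∧ t (i + 1) = true := by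
  by_contra! hcon
  obtain ⟨i, hi⟩ := h0
  obtain ⟨j, hj⟩ := h1
  have key : ∀ k : Fin (m + 1), t (i + k) = false := by
    intro k
    induction k using Fin.induction with
    | zero => simpa using hi
    | succ k ih =>
      rw [← Fin.coeSucc_eq_succ, ← add_assoc]
      simpa using hcon _ ih
  simpa [hj] using key (j - i)

/-- A cyclic marked arrangement can be unfolded into an unmarked one. -/
theorem exists_perm_of_marked {m : ℕ} {R : Fin (m + 1) → Fin (m + 1) → Prop}
    {P Q : Fin (m + 1) → Prop} (hPQ : ∀ a b, P a → Q b → R a b) (t : Fin (m + 1) → Bool)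
    (hS : ∀ i, match t i, t (cycSucc i) with
      | false, false => R i (cycSucc i)
      | true, true => R (cycSucc i) i
      | false, true => P i ∧ P (cycSucc i)
      | true, false => Q i ∧ Q (cycSucc i)) :
    ∃ δ : Equiv.Perm (Fin (m + 1)), ∀ i, R (δ i) (δ (cycSucc i)) := by
  simp only [cycSucc_eq_add_one] at hS
  by_cases h1 : ∃ i, t i = true
  swap
  · have ht : ∀ i, t i = false := by simpa using h1
    exact ⟨1, fun i => by simpa [ht, cycSucc_eq_add_one] using hS i⟩
  by_cases h0 : ∃ i, t i = false
  swap
  · have ht : ∀ i, t i = true := by simpa using h0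
    refine ⟨Equiv.neg _, fun i => ?_⟩
    simpa [ht, cycSucc_eq_add_one] using hS (-(i + 1))
  obtain ⟨k, hk0, hk1⟩ := exists_false_true_of_not_constant t h0 h1
  have hk := hS k
  simp only [hk0, hk1] at hk
  have hL : List.ofFn (fun j : Fin (m + 1) => k + 1 + j) =
      (k + 1) :: List.ofFn (fun j : Fin m => k + 1 + j.succ) := by
    simp [List.ofFn_succ]
  obtain ⟨l, hl, hR, h, hh, e, he, hinv⟩ := exists_perm_isChain_of_marked hPQ t
    (List.ofFn (fun j : Fin m => k + 1 + j.succ)) (k + 1)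
    (by
      rw [← hL, List.isChain_iff_getElem]
      intro i hi
      simp only [List.length_ofFn] at hi
      have hi' : (⟨i + 1, hi⟩ : Fin (m + 1)) = ⟨i, by omega⟩ + 1 := by
        ext
        simp [Fin.val_add, Nat.mod_eq_of_lt hi]
      have := hS (k + 1 + ⟨i, by omega⟩)
      simpa only [List.getElem_ofFn, hi', ← add_assoc] using this)
    (by
      rw [← hL]
      intro z hz
      have hlast : k + 1 + Fin.last m = k := by
        rw [add_assoc, add_comm 1, Fin.last_add_one, add_zero]
      have hzk : z = k := by
        rw [List.ofFn_succ', List.concat_eq_append] at hz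
        simpa [hlast, eq_comm] using hz
      exact hzk ▸ ⟨hk0, hk.1⟩)
  rw [← hL] at hl
  rw [if_pos hk1] at hinv
  refine exists_perm_of_isChain (hl.trans ?_) hR hh he (hPQ _ _ (hinv.1 ▸ hk.2) hinv.2)
  refine (List.perm_ext_iff_of_nodup (List.nodup_ofFn.2 (add_right_injective _))
    (List.nodup_finRange _)).2 fun a => ?_
  simp only [List.mem_ofFn, List.mem_finRange, iff_true]
  exact ⟨a - (k + 1), by simp⟩

/-- The reduction from 2SLW to the RA4 decision problem (Theorem 6): with
`Wmax = max_i max (W_{i1}, W_{i2})`, `ρ = 2π / ∑_j (W_{j1} + W_{j2} + Wmax)`,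
`w₀(i) = W_{i1}·ρ`, `w₁(i) = (W_{i2} + Wmax)·ρ`, `A = (LB + Wmax)·ρ` and
`B = (UB + Wmax)·ρ`, a circular schedule `δ` keeping every workforce requirement
`W_{δ_i,2} + W_{δ_{i⊕1},1}` in `[LB, UB]` exists iff a drawing `(σ, t)` keeping every
angle in `[A, B]` exists. -/
theorem RA4_reduction_from_2SLW (n : ℕ) (hn : 1 ≤ n) (W1 W2 : Fin n → ℝ)
    (hW1 : ∀ i, 0 < W1 i) (hW2 : ∀ i, 0 < W2 i)
    (LB UB : ℝ) (hLU : LB ≤ UB) (Wmax ρ A B : ℝ)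
    (hWmax : (∀ i, W1 i ≤ Wmax ∧ W2 i ≤ Wmax) ∧ ∃ i, Wmax = W1 i ∨ Wmax = W2 i)
    (hρ : ρ = 2 * Real.pi / ∑ i : Fin n, (W1 i + W2 i + Wmax))
    (hA : A = (LB + Wmax) * ρ) (hB : B = (UB + Wmax) * ρ) :
    (∃ δ : Equiv.Perm (Fin n), ∀ i : Fin n,
        LB ≤ W2 (δ i) + W1 (δ (cycSucc i)) ∧ W2 (δ i) + W1 (δ (cycSucc i)) ≤ UB)
    ↔
    (∃ (σ : Equiv.Perm (Fin n)) (t : Fin n → Bool), ∀ i : Fin n,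
        A ≤ theta (fun j c => if c then (W2 j + Wmax) * ρ else W1 j * ρ) σ t i ∧
        theta (fun j c => if c then (W2 j + Wmax) * ρ else W1 j * ρ) σ t i ≤ B) := by
  obtain ⟨m, rfl⟩ : ∃ m, n = m + 1 := ⟨n - 1, by omega⟩
  obtain ⟨hle, -⟩ := hWmax
  have hWpos : 0 < Wmax := (hW1 0).trans_le (hle 0).1
  have hρpos : 0 < ρ := by
    rw [hρ]
    refine div_pos (by positivity) (Finset.sum_pos (fun i _ => ?_) Finset.univ_nonempty)
    linarith [hW1 i, hW2 i]
  have scale : ∀ x y : ℝ, x * ρ ≤ y * ρ ↔ x ≤ y := fun x y => mul_le_mul_iff_left₀ hρpos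
  subst hA hB
  constructor
  · rintro ⟨δ, hδ⟩
    refine ⟨δ, fun _ => false, fun i => ?_⟩
    simp only [theta, Bool.not_false, if_true, Bool.false_eq_true, if_false, ← add_mul, scale]
    constructor <;> linarith [(hδ i).1, (hδ i).2]
  · rintro ⟨σ, t, hθ⟩
    obtain ⟨δ, hδ⟩ := exists_perm_of_marked
      (R := fun a b => LB ≤ W2 (σ a) + W1 (σ b) ∧ W2 (σ a) + W1 (σ b) ≤ UB)
      (P := fun a => W2 (σ a) + Wmax ≤ UB) (Q := fun b => LB ≤ W1 (σ b))
      (fun a b ha hb => by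
        constructor <;> linarith [hW2 (σ a), (hle (σ b)).1]) t (fun i => by
        have hi := hθ i
        have p1 := hW2 (σ i)
        have p2 := hW2 (σ (cycSucc i))
        have q1 := (hle (σ i)).1
        have q2 := (hle (σ (cycSucc i))).1
        cases h0 : t i <;> cases h1 : t (cycSucc i) <;>
          simp only [theta, h0, h1, Bool.not_false, Bool.not_true, if_true, Bool.false_eq_true,
            if_false, ← add_mul, scale] at hi ⊢ <;>
          constructor <;> linarith [hi.1, hi.2])
    exact ⟨δ.trans σ, hδ⟩
end
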